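/- arXiv:2405.04858 — 3 statements merged into one kernel-verified Lean document; each statement's English description precedes it below -/
import Mathlib

section
/- Let m ∈ ℝ, v ∈ ℝ≥0, and s ∈ {-1, 1}. Then the function x ↦ Real.log (1 + Real.exp (-s * x)) is integrable with respect to the Gaussian measure gaussianReal m v on ℝ, and ∫ Real.log (1 + Real.exp (-s * x)) ∂(gaussianReal m v) ≤ Real.log (1 + Real.exp (-s * m + v / 2)). -/
open MeasureTheory ProbabilityTheory

/-- Jensen's inequality for the concave function `log (1 + ·)`. -/
theorem integral_log_one_add_le {α : Type*} [MeasurableSpace α] {μ : Measure α}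
    [IsProbabilityMeasure μ] {f : α → ℝ} (hf : 0 ≤ f) (hfi : Integrable f μ) :
    Integrable (fun x => Real.log (1 + f x)) μ ∧
      ∫ x, Real.log (1 + f x) ∂μ ≤ Real.log (1 + ∫ x, f x ∂μ) := by
  have hfi' : Integrable (fun x => 1 + f x) μ := (integrable_const 1).add hfi
  have hlog : Integrable (fun x => Real.log (1 + f x)) μ := by
    refine hfi.mono' (Real.measurable_log.comp_aemeasurable hfi'.aemeasurable).aestronglyMeasurable
      (.of_forall fun x => ?_)
    have hx : 0 ≤ f x := hf x
    rw [Real.norm_of_nonneg (Real.log_nonneg (by linarith))]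
    linarith [Real.log_le_sub_one_of_pos (show 0 < 1 + f x by linarith)]
  refine ⟨hlog, ?_⟩
  have hsub : Set.Ici (1 : ℝ) ⊆ Set.Ioi 0 := Set.Ici_subset_Ioi.2 one_pos
  have hconc : ConcaveOn ℝ (Set.Ici 1) Real.log :=
    strictConcaveOn_log_Ioi.concaveOn.subset hsub (convex_Ici 1)
  have hcont : ContinuousOn Real.log (Set.Ici 1) :=
    Real.continuousOn_log.mono fun x hx => (hsub hx).ne'
  have hmem : ∀ᵐ x ∂μ, 1 + f x ∈ Set.Ici (1 : ℝ) :=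
    .of_forall fun x => le_add_of_nonneg_right (hf x)
  have hjensen := hconc.le_map_integral hcont isClosed_Ici hmem hfi' hlog
  rwa [integral_add (integrable_const 1) hfi, integral_const, probReal_univ, one_smul] at hjensen

/-- The expected binary cross-entropy (softplus) loss `log (1 + exp (-s * x))` of a
Gaussian-distributed classifier score `x ~ N(m, v)` is integrable and upper bounded by
`log (1 + exp (-s * m + v / 2))` (Jensen + Gaussian moment-generating function). -/
theorem gaussian_bce_integrable_and_bound (m : ℝ) (v : NNReal) (s : ℝ)
    (hs : s = -1 ∨ s = 1) :
    Integrable (fun x : ℝ => Real.log (1 + Real.exp (-s * x))) (gaussianReal m v) ∧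
      ∫ x, Real.log (1 + Real.exp (-s * x)) ∂(gaussianReal m v) ≤
        Real.log (1 + Real.exp (-s * m + (v : ℝ) / 2)) := by
  have hmgf : ∫ x, Real.exp (-s * x) ∂(gaussianReal m v) =
      Real.exp (-s * m + (v : ℝ) / 2) := by
    have hs2 : (-s) ^ 2 = 1 := by rcases hs with rfl | rfl <;> norm_num
    have h := congrFun (mgf_id_gaussianReal (μ := m) (v := v)) (-s)
    rw [hs2, mul_one, mul_comm m] at h
    exact h
  rw [← hmgf]
  exact integral_log_one_add_le (fun x => (Real.exp_pos _).le)
    (integrable_exp_mul_gaussianReal (-s))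
end

section
/- Let E be a real inner product space that is a measurable space with the Borel σ-algebra, let μ be a Borel probability measure on E, let w ∈ E, b m ∈ ℝ, v ∈ ℝ≥0, and s ∈ {-1, 1}. If the pushforward of μ under the map x ↦ ⟪w, x⟫ equals gaussianReal m v, then ∫ Real.log (1 + Real.exp (-s * (⟪w, x⟫ + b))) ∂μ ≤ Real.log (1 + Real.exp (-s * (m + b) + v / 2)). -/
open MeasureTheory ProbabilityTheory RealInnerProductSpace

/-- Jensen's inequality for `log`, for functions bounded below by `1`. -/
theorem integral_log_le_log_integral_of_one_le {Ω : Type*} [MeasurableSpace Ω] {μ : Measure Ω}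
    [IsProbabilityMeasure μ] {f : Ω → ℝ} (hf : Integrable f μ) (hone : ∀ x, 1 ≤ f x) :
    ∫ x, Real.log (f x) ∂μ ≤ Real.log (∫ x, f x ∂μ) := by
  set a := ∫ x, f x ∂μ with ha
  have ha_pos : 0 < a := by
    have : ∫ _, (1 : ℝ) ∂μ ≤ a := integral_mono (integrable_const 1) hf hone
    simp only [integral_const, probReal_univ, smul_eq_mul, mul_one] at this
    linarith
  have tangent (x : Ω) : Real.log (f x) ≤ f x / a - 1 + Real.log a := by
    have hx : 0 < f x := one_pos.trans_le (hone x)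
    have h := Real.log_le_sub_one_of_pos (div_pos hx ha_pos)
    rw [Real.log_div hx.ne' ha_pos.ne'] at h
    linarith
  have hint : Integrable (fun x => f x / a - 1) μ := (hf.div_const a).sub (integrable_const 1)
  calc ∫ x, Real.log (f x) ∂μ
      ≤ ∫ x, (f x / a - 1 + Real.log a) ∂μ :=
        integral_mono_of_nonneg (.of_forall fun x => Real.log_nonneg (hone x))
          (hint.add (integrable_const _)) (.of_forall tangent)
    _ = Real.log a := by
        rw [integral_add hint (integrable_const _),
          integral_sub (hf.div_const a) (integrable_const 1), integral_div, ← ha,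
          div_self ha_pos.ne']
        simp

/-- If the classifier score `⟪w, x⟫` of features `x ~ μ` is Gaussian distributed `N(m, v)`,
then the expected binary cross-entropy loss of the linear classifier with weight `w` and
bias `b` is upper bounded by `log (1 + exp (-s * (m + b) + v / 2))`. -/
theorem gaussian_score_bce_bound {E : Type*} [NormedAddCommGroup E] [InnerProductSpace ℝ E]
    [MeasurableSpace E] [BorelSpace E] (μ : Measure E) [IsProbabilityMeasure μ]
    (w : E) (b m : ℝ) (v : NNReal) (s : ℝ) (hs : s = -1 ∨ s = 1)
    (hmap : μ.map (fun x => ⟪w, x⟫) = gaussianReal m v) :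
    ∫ x, Real.log (1 + Real.exp (-s * (⟪w, x⟫ + b))) ∂μ ≤
      Real.log (1 + Real.exp (-s * (m + b) + (v : ℝ) / 2)) := by
  have hsq : s ^ 2 = 1 := by rcases hs with rfl | rfl <;> norm_num
  have hexp (x : E) :
      Real.exp (-s * (⟪w, x⟫ + b)) = Real.exp (-s * b) * Real.exp (-s * ⟪w, x⟫) := by
    rw [← Real.exp_add]
    ring_nf
  have hmgf := mgf_gaussianReal hmap (-s)
  have hint : Integrable (fun x => Real.exp (-s * (⟪w, x⟫ + b))) μ := by
    simp_rw [hexp]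
    refine Integrable.const_mul ?_ _
    rw [← mgf_pos_iff, hmgf]
    exact Real.exp_pos _
  have hval : ∫ x, (1 + Real.exp (-s * (⟪w, x⟫ + b))) ∂μ =
      1 + Real.exp (-s * (m + b) + (v : ℝ) / 2) := by
    rw [integral_add (integrable_const 1) hint]
    simp_rw [hexp]
    rw [integral_const_mul]
    rw [mgf] at hmgf
    rw [hmgf, ← Real.exp_add, neg_sq, hsq]
    simp only [integral_const, probReal_univ, smul_eq_mul, mul_one]
    ring_nf
  rw [← hval]
  exact integral_log_le_log_integral_of_one_le ((integrable_const 1).add hint)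
    fun x => le_add_of_nonneg_right (Real.exp_pos _).le
end

section
/- Let N C : ℕ and y : Fin N → Fin C → ℝ take values in {0, 1}. Suppose there are attributes k l : Fin C such that yᵢˡ ≤ yᵢᵏ for all i and yᵢ₀ˡ < yᵢ₀ᵏ for some i₀. Then there is no a : Fin N → ℝ with aᵢ > 0 for all i, ∑ i, aᵢ = 1, ∑ i, aᵢ * yᵢᵏ = 1/2, and ∑ i, aᵢ * yᵢˡ = 1/2. -/
/-- The curse of label co-occurrence: if attribute `l` strictly implies attribute `k` in
the dataset, no positive sampling weighting can simultaneously balance the label priors of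
both attributes to `1/2`. -/
theorem no_joint_balance_of_strict_implication (N C : ℕ) (y : Fin N → Fin C → ℝ)
    (hy : ∀ i k, y i k = 0 ∨ y i k = 1) (k l : Fin C)
    (hle : ∀ i, y i l ≤ y i k) (i₀ : Fin N) (hlt : y i₀ l < y i₀ k) :
    ¬ ∃ a : Fin N → ℝ, (∀ i, 0 < a i) ∧ (∑ i, a i = 1) ∧
      (∑ i, a i * y i k = 1 / 2) ∧ (∑ i, a i * y i l = 1 / 2) := by
  rintro ⟨a, ha, -, hk, hl⟩
  have h : ∑ i, a i * y i l < ∑ i, a i * y i k :=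
    Finset.sum_lt_sum (fun i _ => mul_le_mul_of_nonneg_left (hle i) (ha i).le)
      ⟨i₀, Finset.mem_univ i₀, mul_lt_mul_of_pos_left hlt (ha i₀)⟩
  exact h.ne (hl.trans hk.symm)
end
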